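/- There exists a subgroup G ≤ W isomorphic to the direct product S₃ × S₃ of two symmetric groups on three letters such that: the action of G on the 240 exceptional classes has exactly 23 orbits, with orbit-length multiset consisting of two orbits of length 2, four of length 3, two of length 4, six of length 6, six of length 12, and three of length 36; G is minimal; G fixes a conic class; and G satisfies condition (H1). -/

import Mathlib

open scoped BigOperators

noncomputable section

/-- The Picard lattice of a degree 1 del Pezzo surface. -/
abbrev V : Type := Fin 9 → ℤ

/-- The intersection form. -/
def bil (x y : V) : ℤ := x 0 * y 0 - ∑ i ∈ Finset.Ioi (0 : Fin 9), x i * y i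

/-- The canonical class. -/
def Kvec : V := fun i => if i = 0 then -3 else 1

abbrev LatAut := V ≃ₗ[ℤ] V

/-- The Weyl group: automorphisms preserving the form and fixing K. -/
def W : Subgroup LatAut where
  carrier := {g | (∀ x y, bil (g x) (g y) = bil x y) ∧ g Kvec = Kvec}
  one_mem' := ⟨fun _ _ => rfl, rfl⟩
  mul_mem' := by
    rintro a b ⟨ha1, ha2⟩ ⟨hb1, hb2⟩
    refine ⟨fun x y => ?_, ?_⟩
    · show bil (a (b x)) (a (b y)) = bil x y
      rw [ha1, hb1]
    · show a (b Kvec) = Kvec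
      rw [hb2, ha2]
  inv_mem' := by
    rintro a ⟨ha1, ha2⟩
    refine ⟨fun x y => ?_, ?_⟩
    · have h := ha1 (a⁻¹ x) (a⁻¹ y)
      have hx : a (a⁻¹ x) = x := a.apply_symm_apply x
      have hy : a (a⁻¹ y) = y := a.apply_symm_apply y
      rw [hx, hy] at h
      exact h.symm
    · have h2 : a.symm (a Kvec) = a.symm Kvec := by rw [ha2]
      rw [a.symm_apply_apply] at h2
      exact (show a⁻¹ Kvec = a.symm Kvec from rfl).trans h2.symm

/-- Exceptional classes. -/
def Exc : Set V := {E | bil E E = -1 ∧ bil E Kvec = -1}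

/-- Conic classes. -/
def IsConic (C : V) : Prop := bil C C = 0 ∧ bil C Kvec = -2

/-- The orbit of a vector under a subgroup of `LatAut`. -/
def orb (G : Subgroup LatAut) (E : V) : Set V := {v | ∃ g ∈ G, g E = v}

/-- The set of orbits of exceptional classes. -/
def orbs (G : Subgroup LatAut) : Set (Set V) := {S | ∃ E ∈ Exc, S = orb G E}

/-- The stabilizer of a vector, as a subgroup of `LatAut`. -/
def stab (G : Subgroup LatAut) (E : V) : Subgroup LatAut where
  carrier := {g | g ∈ G ∧ g E = E}
  one_mem' := ⟨G.one_mem, rfl⟩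
  mul_mem' := by
    rintro a b ⟨haG, ha⟩ ⟨hbG, hb⟩
    exact ⟨G.mul_mem haG hbG, by show a (b E) = E; rw [hb, ha]⟩
  inv_mem' := by
    rintro a ⟨haG, ha⟩
    refine ⟨G.inv_mem haG, ?_⟩
    conv_lhs => rw [← ha]
    exact a.symm_apply_apply E

/-- `G` is minimal: no nonempty orbit of exceptional classes consists of pairwise
orthogonal classes. -/
def MinimalAction (G : Subgroup LatAut) : Prop :=
  ∀ E ∈ Exc, ¬ (∀ E₁ ∈ orb G E, ∀ E₂ ∈ orb G E, E₁ ≠ E₂ → bil E₁ E₂ = 0)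

/-- The natural representation of a subgroup of `LatAut` on the lattice. -/
def rep (G : Subgroup LatAut) : Representation ℤ G V where
  toFun g := (g : LatAut).toLinearMap
  map_one' := rfl
  map_mul' _ _ := rfl

/-- Condition (H1): the first group cohomology of every subgroup of `G`
with coefficients in the lattice vanishes. -/
def CondH1 (G : Subgroup LatAut) : Prop :=
  ∀ G' : Subgroup LatAut, G' ≤ G →
    Subsingleton (groupCohomology.H1 (Rep.of (rep G')))

open Equiv (Perm)

theorem bil_eq (x y : V) : bil x y = x 0 * y 0 - x 1 * y 1 - x 2 * y 2 - x 3 * y 3 - x 4 * y 4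
    - x 5 * y 5 - x 6 * y 6 - x 7 * y 7 - x 8 * y 8 := by
  have h : Finset.Ioi (0 : Fin 9) = {1, 2, 3, 4, 5, 6, 7, 8} := by decide
  rw [bil, h]
  simp only [Finset.sum_insert, Finset.mem_insert, Finset.mem_singleton, Finset.sum_singleton,
    Fin.reduceEq, or_self, not_false_eq_true]
  ring

/-- The permutation action of `Perm (Fin 3)` on the coordinates `3, 4, 5`. -/
def permBlock (σ : Perm (Fin 3)) : V →ₗ[ℤ] V where
  toFun x := ![x 0, x 1, x 2, ![x 3, x 4, x 5] (σ⁻¹ 0), ![x 3, x 4, x 5] (σ⁻¹ 1),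
    ![x 3, x 4, x 5] (σ⁻¹ 2), x 6, x 7, x 8]
  map_add' x y := by
    have h : ![(x + y) 3, (x + y) 4, (x + y) 5] = ![x 3, x 4, x 5] + ![y 3, y 4, y 5] := by simp
    rw [h]
    ext i
    fin_cases i <;> rfl
  map_smul' c x := by
    have h : ![(c • x) 3, (c • x) 4, (c • x) 5] = c • ![x 3, x 4, x 5] := by simp
    rw [h]
    ext i
    fin_cases i <;> rfl

/-- The isometry exchanging `Eᵢ` with `C - Eᵢ` for `i = 2, 3, 4, 5`, where `C` is the conic
class `(1, -1, 0, …, 0)`. -/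
def flipBlock : V →ₗ[ℤ] V where
  toFun x := ![x 0 + (2 * (x 0 + x 1) + x 2 + x 3 + x 4 + x 5),
    x 1 - (2 * (x 0 + x 1) + x 2 + x 3 + x 4 + x 5),
    -x 2 - (x 0 + x 1), -x 3 - (x 0 + x 1), -x 4 - (x 0 + x 1), -x 5 - (x 0 + x 1), x 6, x 7, x 8]
  map_add' x y := by
    ext i
    fin_cases i <;> simp <;> ring
  map_smul' c x := by
    ext i
    fin_cases i <;> simp <;> ring

/-- The exchange of the coordinate blocks `3, 4, 5` and `6, 7, 8`. -/
def exchange : V →ₗ[ℤ] V where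
  toFun x := ![x 0, x 1, x 2, x 6, x 7, x 8, x 3, x 4, x 5]
  map_add' x y := by
    ext i
    fin_cases i <;> rfl
  map_smul' c x := by
    ext i
    fin_cases i <;> rfl

/-- The first factor `S₃`: permutations of the block `3, 4, 5`, twisted by `flipBlock` on odd
permutations. -/
def actFirst (σ : Perm (Fin 3)) : V →ₗ[ℤ] V :=
  if σ 1 = σ 0 + 1 then permBlock σ else flipBlock ∘ₗ permBlock σ

/-- The second factor `S₃`, acting in the same way through the block `6, 7, 8`. -/
def actSecond (σ : Perm (Fin 3)) : V →ₗ[ℤ] V := exchange ∘ₗ actFirst σ ∘ₗ exchange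

/-- The action of `S₃ × S₃` on the lattice. -/
def act (s : Perm (Fin 3) × Perm (Fin 3)) : V →ₗ[ℤ] V := actFirst s.1 ∘ₗ actSecond s.2

theorem exchange_exchange (x : V) : exchange (exchange x) = x := by
  ext i
  fin_cases i <;> rfl

theorem permBlock_mul (σ τ : Perm (Fin 3)) (x : V) :
    permBlock (σ * τ) x = permBlock σ (permBlock τ x) := by
  have h (j : Fin 3) : ![x 3, x 4, x 5] (τ⁻¹ j) =
      ![permBlock τ x 3, permBlock τ x 4, permBlock τ x 5] j := by
    fin_cases j <;> simp [permBlock]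
  ext i
  fin_cases i <;> simp [permBlock] at h ⊢ <;> exact h _

theorem permBlock_flipBlock (σ : Perm (Fin 3)) (x : V) :
    permBlock σ (flipBlock x) = flipBlock (permBlock σ x) := by
  have h := Equiv.sum_comp σ⁻¹ ![x 3, x 4, x 5]
  have h' : ∀ j, ![-x 3 - (x 0 + x 1), -x 4 - (x 0 + x 1), -x 5 - (x 0 + x 1)] j =
      -![x 3, x 4, x 5] j - (x 0 + x 1) := by
    intro j
    fin_cases j <;> rfl
  rw [Fin.sum_univ_three, Fin.sum_univ_three] at h
  ext i
  fin_cases i <;> simp [permBlock, flipBlock, h'] at h ⊢ <;> linarith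

theorem flipBlock_flipBlock (x : V) : flipBlock (flipBlock x) = x := by
  ext i
  fin_cases i <;> simp [flipBlock] <;> ring

theorem actFirst_apply (σ : Perm (Fin 3)) (x : V) :
    actFirst σ x = if σ 1 = σ 0 + 1 then permBlock σ x else flipBlock (permBlock σ x) := by
  unfold actFirst
  split_ifs <;> rfl

theorem actFirst_mul (σ τ : Perm (Fin 3)) : actFirst (σ * τ) = actFirst σ ∘ₗ actFirst τ := by
  have h : ∀ σ τ : Perm (Fin 3), (σ * τ) 1 = (σ * τ) 0 + 1 ↔
      (σ 1 = σ 0 + 1 ↔ τ 1 = τ 0 + 1) := by decide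
  refine LinearMap.ext fun x => ?_
  simp only [LinearMap.comp_apply, actFirst_apply, h]
  split_ifs <;> simp_all [permBlock_mul, permBlock_flipBlock, flipBlock_flipBlock]

theorem actFirst_one : actFirst 1 = LinearMap.id := by
  refine LinearMap.ext fun x => ?_
  ext i
  fin_cases i <;> rfl

theorem actFirst_comm_actSecond (σ τ : Perm (Fin 3)) (x : V) :
    actFirst σ (actSecond τ x) = actSecond τ (actFirst σ x) := by
  have hpp (x : V) : permBlock σ (exchange (permBlock τ (exchange x))) =
      exchange (permBlock τ (exchange (permBlock σ x))) := by
    ext i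
    fin_cases i <;> simp [permBlock, exchange]
  have hpf (σ : Perm (Fin 3)) (x : V) : permBlock σ (exchange (flipBlock (exchange x))) =
      exchange (flipBlock (exchange (permBlock σ x))) := by
    ext i
    fin_cases i <;> simp [permBlock, flipBlock, exchange]
  have hff (x : V) : flipBlock (exchange (flipBlock (exchange x))) =
      exchange (flipBlock (exchange (flipBlock x))) := by
    ext i
    fin_cases i <;> simp [flipBlock, exchange] <;> ring
  have hfp (x : V) : flipBlock (exchange (permBlock τ (exchange x))) =
      exchange (permBlock τ (exchange (flipBlock x))) := by
    have h := hpf τ (exchange x)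
    rw [exchange_exchange] at h
    rw [h, exchange_exchange]
  have hpf' (x : V) : permBlock σ (exchange (flipBlock (permBlock τ (exchange x)))) =
      exchange (flipBlock (permBlock τ (exchange (permBlock σ x)))) := by
    have h := hpf σ (exchange (permBlock τ (exchange x)))
    rwa [exchange_exchange, hpp, exchange_exchange] at h
  have hff' (x : V) : flipBlock (exchange (flipBlock (permBlock τ (exchange x)))) =
      exchange (flipBlock (permBlock τ (exchange (flipBlock x)))) := by
    have h := hff (exchange (permBlock τ (exchange x)))
    rwa [exchange_exchange, hfp, exchange_exchange] at h
  simp only [actSecond, LinearMap.comp_apply, actFirst_apply]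
  split_ifs
  · exact hpp x
  · exact hpf' x
  · rw [hpp, hfp]
  · rw [hpf', hff']

theorem act_mul (s t : Perm (Fin 3) × Perm (Fin 3)) : act (s * t) = act s ∘ₗ act t := by
  refine LinearMap.ext fun x => ?_
  have h := actFirst_comm_actSecond t.1 s.2 (actSecond t.2 x)
  simp only [act, actSecond, Prod.fst_mul, Prod.snd_mul, actFirst_mul, LinearMap.comp_apply,
    exchange_exchange] at h ⊢
  rw [h]

theorem act_one : act 1 = LinearMap.id := by
  refine LinearMap.ext fun x => ?_
  simp only [act, actSecond, Prod.fst_one, Prod.snd_one, actFirst_one, LinearMap.comp_apply,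
    LinearMap.id_apply, exchange_exchange]

/-- The action of `S₃ × S₃` as a homomorphism to the automorphism group of the lattice. -/
def actHom : Perm (Fin 3) × Perm (Fin 3) →* LatAut where
  toFun s := LinearEquiv.ofLinearMap (act s) (act s⁻¹)
    (by rw [← act_mul, mul_inv_cancel, act_one]) (by rw [← act_mul, inv_mul_cancel, act_one])
  map_one' := by
    ext1 x
    exact LinearMap.congr_fun act_one x
  map_mul' s t := by
    ext1 x
    exact LinearMap.congr_fun (act_mul s t) x

theorem actHom_apply (s : Perm (Fin 3) × Perm (Fin 3)) (x : V) : actHom s x = act s x := rfl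

theorem actHom_injective : Function.Injective actHom := by
  rw [injective_iff_map_eq_one]
  intro s hs
  have h (i : Fin 9) : act s (Pi.single i 1) = Pi.single i 1 := by
    rw [← actHom_apply, hs]
    rfl
  revert s
  suffices ∀ s, (∀ i, act s (Pi.single i 1) = Pi.single i 1) → s = 1 from fun s _ h => this s h
  decide +kernel

theorem bil_permBlock (σ : Perm (Fin 3)) (x y : V) :
    bil (permBlock σ x) (permBlock σ y) = bil x y := by
  have h := Equiv.sum_comp σ⁻¹ fun j => ![x 3, x 4, x 5] j * ![y 3, y 4, y 5] j
  rw [Fin.sum_univ_three, Fin.sum_univ_three] at h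
  simp only [bil_eq]
  simp [permBlock] at h ⊢
  linarith

theorem bil_flipBlock (x y : V) : bil (flipBlock x) (flipBlock y) = bil x y := by
  simp [bil_eq, flipBlock]
  ring

theorem bil_exchange (x y : V) : bil (exchange x) (exchange y) = bil x y := by
  simp [bil_eq, exchange]
  ring

theorem bil_actFirst (σ : Perm (Fin 3)) (x y : V) :
    bil (actFirst σ x) (actFirst σ y) = bil x y := by
  simp only [actFirst_apply]
  split_ifs
  · exact bil_permBlock σ x y
  · rw [bil_flipBlock, bil_permBlock]

theorem bil_act (s : Perm (Fin 3) × Perm (Fin 3)) (x y : V) :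
    bil (act s x) (act s y) = bil x y := by
  simp only [act, actSecond, LinearMap.comp_apply, bil_actFirst, bil_exchange]

theorem act_Kvec : ∀ s, act s Kvec = Kvec := by
  decide +kernel

theorem range_actHom_le_W : actHom.range ≤ W := by
  rintro _ ⟨s, rfl⟩
  exact ⟨bil_act s, act_Kvec s⟩

/-- A group of isometries stabilizing a multiset of pairs `(v, l)` with `x = ∑ ⟨l, x⟩ v` for
every `x` makes the lattice a direct summand of a permutation module; hence its first cohomology
vanishes. -/
theorem subsingleton_H1_of_frame (G : Subgroup LatAut) [Finite G] (hG : G ≤ W)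
    (F : Multiset (V × V)) (hF : ∀ g ∈ G, F.map (fun p => (g p.1, g p.2)) = F)
    (hid : ∀ x : V, (F.map fun p => bil p.2 x • p.1).sum = x) :
    Subsingleton (groupCohomology.H1 (Rep.of (rep G))) := by
  have := Fintype.ofFinite G
  have bil_add (l x y : V) : bil l (x + y) = bil l x + bil l y := by
    simp only [bil_eq, Pi.add_apply]
    ring
  have hn : (Fintype.card G : ℤ) ≠ 0 := by exact_mod_cast Fintype.card_ne_zero
  refine subsingleton_of_forall_eq 0 fun z => ?_
  induction z using groupCohomology.H1_induction_on with | h f => ?_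
  rw [groupCohomology.H1π_eq_zero_iff]
  have hf (g h : G) : f (g * h) = (g : LatAut) (f h) + f g :=
    (groupCohomology.mem_cocycles₁_iff f).1 f.2 g h
  let S (l : V) : ℤ := ∑ h : G, bil l (f h)
  have hS (g : G) (l : V) : Fintype.card G * bil ((g : LatAut) l) (f g) =
      S ((g : LatAut) l) - S l := by
    have h1 : S ((g : LatAut) l) = ∑ h : G, bil ((g : LatAut) l) (f (g * h)) :=
      (Equiv.sum_comp (Equiv.mulLeft g) fun h => bil ((g : LatAut) l) (f h)).symm
    have h2 (h : G) : bil ((g : LatAut) l) (f (g * h)) =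
        bil l (f h) + bil ((g : LatAut) l) (f g) := by
      rw [hf, bil_add, (hG g.2).1]
    rw [h1, Finset.sum_congr rfl fun h _ => h2 h, Finset.sum_add_distrib]
    simp [S]
  let b (l : V) : ℤ := S l / Fintype.card G
  have hb (g : G) (l : V) : bil ((g : LatAut) l) (f g) = b ((g : LatAut) l) - b l := by
    have h : S ((g : LatAut) l) = S l + Fintype.card G * bil ((g : LatAut) l) (f g) := by
      rw [hS]
      ring
    simp only [b]
    rw [h, Int.add_mul_ediv_left _ _ hn]
    ring
  let y : V := (F.map fun p => b p.2 • p.1).sum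
  refine ⟨-y, funext fun g => ?_⟩
  have hg : f g = y - (g : LatAut) y := by
    have h1 : y = (F.map fun p => b ((g : LatAut) p.2) • (g : LatAut) p.1).sum := by
      conv_lhs => simp only [y]
      conv_lhs => rw [← hF g g.2]
      rw [Multiset.map_map]
      rfl
    have h2 : (g : LatAut) y = (F.map fun p => b p.2 • (g : LatAut) p.1).sum := by
      simp only [y]
      rw [map_multiset_sum, Multiset.map_map]
      simp only [Function.comp_apply, map_smul]
    rw [h2]
    conv_rhs => rw [h1]
    rw [← Multiset.sum_map_sub, ← hid (f g)]
    conv_lhs => rw [← hF g g.2]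
    rw [Multiset.map_map]
    simp only [Function.comp_apply, hb, sub_smul]
  rw [hg]
  change (g : LatAut) (-y) - -y = _
  rw [map_neg]
  abel

/-- Representatives of the orbits of exceptional classes. -/
def orbRep : Fin 23 → V :=
  ![![0, 0, 1, 0, 0, 0, 0, 0, 0], ![5, -1, -1, -2, -2, -2, -2, -2, -2],
    ![3, -1, -1, -2, -1, 0, -1, -1, -1], ![3, -1, -1, -2, 0, -1, -1, -1, -1],
    ![3, -1, -1, -1, -1, -1, -2, -1, 0], ![3, -1, -1, -1, -1, -1, -2, 0, -1],
    ![0, 1, 0, 0, 0, 0, 0, 0, 0], ![3, 0, -2, -1, -1, -1, -1, -1, -1],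
    ![0, 0, 0, 0, 0, 0, 0, 0, 1], ![0, 0, 0, 0, 0, 1, 0, 0, 0],
    ![2, 0, -1, -1, -1, -1, -1, 0, 0], ![2, 0, -1, -1, 0, 0, -1, -1, -1],
    ![5, -1, -2, -2, -2, -2, -2, -2, -1], ![5, -1, -2, -2, -2, -1, -2, -2, -2],
    ![1, 0, -1, -1, 0, 0, 0, 0, 0], ![1, 0, -1, 0, 0, 0, -1, 0, 0],
    ![2, 0, 0, -1, -1, -1, -1, -1, 0], ![2, 0, 0, -1, -1, 0, -1, -1, -1],
    ![3, 0, -1, -2, -1, -1, -1, -1, -1], ![3, 0, -1, -1, -1, -1, -2, -1, -1],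
    ![1, 0, 0, -1, 0, 0, -1, 0, 0], ![2, 0, -1, -1, -1, 0, -1, -1, 0],
    ![4, -1, -2, -2, -1, -1, -2, -1, -1]]

/-- The lengths of the orbits of exceptional classes. -/
def orbLength : Fin 23 → ℕ :=
  ![2, 2, 3, 3, 3, 3, 4, 4, 6, 6, 6, 6, 6, 6, 12, 12, 12, 12, 12, 12, 36, 36, 36]

theorem card_stabilizer : ∀ k : Fin 23,
    orbLength k * (Finset.univ.filter fun s => act s (orbRep k) = orbRep k).card = 36 := by
  decide +kernel

theorem exists_bil_act : ∀ k : Fin 23, ∃ s,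
    act s (orbRep k) ≠ orbRep k ∧ bil (act s (orbRep k)) (orbRep k) ≠ 0 := by
  simp only [bil_eq]
  decide +kernel

/-- The Vandermonde product of three integers. -/
def vandermonde₃ (a b c : ℤ) : ℤ := (a - b) * (b - c) * (a - c)

/-- An invariant separating the orbits of exceptional classes. -/
def orbInv (x : V) : ℤ × (ℤ × ℤ) × (ℤ × ℤ) :=
  (x 0 + x 1,
    ((2 * (x 3 + x 4 + x 5) + 3 * (x 0 + x 1)) ^ 2, vandermonde₃ (x 3) (x 4) (x 5)),
    ((2 * (x 6 + x 7 + x 8) + 3 * (x 0 + x 1)) ^ 2, vandermonde₃ (x 6) (x 7) (x 8)))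

theorem orbInv_exchange (x : V) :
    orbInv (exchange x) = ((orbInv x).1, (orbInv x).2.2, (orbInv x).2.1) := rfl

theorem orbInv_actFirst (σ : Perm (Fin 3)) (x : V) : orbInv (actFirst σ x) = orbInv x := by
  have h : ∀ σ : Perm (Fin 3),
      (σ 1 = σ 0 + 1 ∧ (σ⁻¹ 0 = 0 ∧ σ⁻¹ 1 = 1 ∧ σ⁻¹ 2 = 2 ∨ σ⁻¹ 0 = 1 ∧ σ⁻¹ 1 = 2 ∧ σ⁻¹ 2 = 0 ∨
        σ⁻¹ 0 = 2 ∧ σ⁻¹ 1 = 0 ∧ σ⁻¹ 2 = 1)) ∨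
      (¬ σ 1 = σ 0 + 1 ∧ (σ⁻¹ 0 = 0 ∧ σ⁻¹ 1 = 2 ∧ σ⁻¹ 2 = 1 ∨
        σ⁻¹ 0 = 1 ∧ σ⁻¹ 1 = 0 ∧ σ⁻¹ 2 = 2 ∨ σ⁻¹ 0 = 2 ∧ σ⁻¹ 1 = 1 ∧ σ⁻¹ 2 = 0)) := by decide
  rw [actFirst_apply]
  rcases h σ with ⟨h, h'⟩ | ⟨h, h'⟩
  · rw [if_pos h]
    rcases h' with ⟨h0, h1, h2⟩ | ⟨h0, h1, h2⟩ | ⟨h0, h1, h2⟩ <;>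
      simp [orbInv, vandermonde₃, permBlock, -Perm.coe_inv, h0, h1, h2] <;>
      constructor <;> ring
  · rw [if_neg h]
    rcases h' with ⟨h0, h1, h2⟩ | ⟨h0, h1, h2⟩ | ⟨h0, h1, h2⟩ <;>
      simp [orbInv, vandermonde₃, permBlock, flipBlock, -Perm.coe_inv, h0, h1, h2] <;>
      refine ⟨?_, ?_⟩ <;> ring_nf

theorem orbInv_act (s : Perm (Fin 3) × Perm (Fin 3)) (x : V) : orbInv (act s x) = orbInv x := by
  simp only [act, actSecond, LinearMap.comp_apply, orbInv_actFirst, orbInv_exchange]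

theorem orbInv_orbRep_injective : Function.Injective fun k => orbInv (orbRep k) := by
  unfold Function.Injective
  decide +kernel

theorem orbRep_mem_Exc (k : Fin 23) : orbRep k ∈ Exc := by
  change bil _ _ = -1 ∧ bil _ _ = -1
  simp only [bil_eq]
  revert k
  decide +kernel

/-- A list containing every integer vector `f` with `∑ (2 fᵢ + d)² = q`, provided that
`0 ≤ d ≤ 4` and `q ≤ 8`. -/
def tails (d : ℤ) : (n : ℕ) → ℤ → List (Fin n → ℤ)
  | 0, _ => [Fin.elim0]
  | n + 1, q => [-3, -2, -1, 0, 1].flatMap fun a =>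
      if n = 0 ∧ (2 * a + d) ^ 2 = q ∨ n ≠ 0 ∧ (2 * a + d) ^ 2 ≤ q then
        (tails d n (q - (2 * a + d) ^ 2)).map (Fin.cons a) else []

theorem mem_tails {d : ℤ} (hd : 0 ≤ d) (hd' : d ≤ 4) {n : ℕ} (f : Fin n → ℤ) {q : ℤ} (hq : q ≤ 8)
    (hf : ∑ i, (2 * f i + d) ^ 2 = q) : f ∈ tails d n q := by
  induction n generalizing q with
  | zero =>
    rw [tails, List.mem_singleton]
    exact Subsingleton.elim _ _
  | succ n ih =>
    rw [Fin.sum_univ_succ] at hf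
    have hnn : 0 ≤ ∑ i : Fin n, (2 * f i.succ + d) ^ 2 := Finset.sum_nonneg fun i _ => sq_nonneg _
    have h0 : (2 * f 0 + d) ^ 2 ≤ q := by linarith
    rw [tails, List.mem_flatMap]
    refine ⟨f 0, ?_, ?_⟩
    · have h1 : 2 * f 0 + d ≤ 2 := by nlinarith
      have h2 : -2 ≤ 2 * f 0 + d := by nlinarith
      have h3 : -3 ≤ f 0 := by lia
      have h4 : f 0 ≤ 1 := by lia
      generalize f 0 = a at h3 h4
      interval_cases a <;> simp
    · rw [if_pos]
      · refine List.mem_map.2 ⟨fun i => f i.succ, ih _ ?_ ?_, Fin.cons_self_tail f⟩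
        · linarith [sq_nonneg (2 * f 0 + d)]
        · linarith
      · rcases n with - | n
        · simp only [Finset.univ_eq_empty, Finset.sum_empty, add_zero] at hf
          exact Or.inl ⟨rfl, hf⟩
        · exact Or.inr ⟨by simp, h0⟩

/-- The candidates for exceptional classes `E` with `⟨E, C⟩ = d`. -/
def candidates (d : ℤ) : List V :=
  ((tails d 7 (8 - (d - 2) ^ 2)).filter
    fun f => (1 - d - (f 0 + f 1 + f 2 + f 3 + f 4 + f 5 + f 6)) % 2 = 0).map fun f =>
      Fin.cons ((1 - d - (f 0 + f 1 + f 2 + f 3 + f 4 + f 5 + f 6)) / 2)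
        (Fin.cons (d - (1 - d - (f 0 + f 1 + f 2 + f 3 + f 4 + f 5 + f 6)) / 2) f)

theorem mem_candidates {E : V} (hE : E ∈ Exc) :
    E ∈ [0, 1, 2, 3, 4].flatMap candidates := by
  obtain ⟨h1, h2⟩ := hE
  rw [bil_eq] at h1 h2
  have hK : ∀ i, Kvec i = ![-3, 1, 1, 1, 1, 1, 1, 1, 1] i := by decide
  simp [hK] at h2
  set d := E 0 + E 1 with hd
  let f : Fin 7 → ℤ := fun i => E i.succ.succ
  have hf : f = ![E 2, E 3, E 4, E 5, E 6, E 7, E 8] := by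
    ext i
    fin_cases i <;> rfl
  have hx : E 0 = (1 - d - (E 2 + E 3 + E 4 + E 5 + E 6 + E 7 + E 8)) / 2 := by lia
  have hsum : ∑ i, (2 * f i + d) ^ 2 = 8 - (d - 2) ^ 2 := by
    have hs : E 2 + E 3 + E 4 + E 5 + E 6 + E 7 + E 8 = 1 - 3 * E 0 - E 1 := by lia
    rw [hf]
    simp [Fin.sum_univ_succ]
    rw [hd]
    linear_combination (-4) * h1 + 4 * (E 0 + E 1) * hs
  have hnn : 0 ≤ ∑ i, (2 * f i + d) ^ 2 := Finset.sum_nonneg fun i _ => sq_nonneg _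
  have hd0 : 0 ≤ d := by nlinarith
  have hd4 : d ≤ 4 := by nlinarith
  rw [List.mem_flatMap]
  refine ⟨d, ?_, List.mem_map.2 ⟨f, List.mem_filter.2 ⟨?_, ?_⟩, ?_⟩⟩
  · clear_value d
    interval_cases d <;> simp
  · exact mem_tails hd0 hd4 f (by linarith [sq_nonneg (d - 2)]) hsum
  · simp [hf]
    lia
  · have e : f 0 + f 1 + f 2 + f 3 + f 4 + f 5 + f 6 =
        E 2 + E 3 + E 4 + E 5 + E 6 + E 7 + E 8 := rfl
    rw [e, ← hx]
    ext i
    fin_cases i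
    · rfl
    · change d - E 0 = E 1
      lia
    all_goals rfl

theorem length_candidates : ([0, 1, 2, 3, 4].flatMap candidates).length = 240 := by
  decide +kernel

/-- A multiset of pairs `(v, l)`, stable under `S₃ × S₃`, with `x = ∑ ⟨l, x⟩ v` for every `x`. -/
def frame : Multiset (V × V) :=
  {(![0, 0, 0, 0, 0, 1, 0, 0, 0], ![0, 0, 0, -1, 0, -1, 0, 0, 0]),
    (![1, -1, 0, 0, -1, 0, 0, 0, 0], ![-2, 2, 0, 1, 1, 0, 0, 0, 0]),
    (![1, -1, 0, 0, 0, -1, 0, 0, 0], ![-2, 2, 0, 0, 1, 1, 0, 0, 0]),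
    (![0, 0, 0, 1, 0, 0, 0, 0, 0], ![0, 0, 0, -1, -1, 0, 0, 0, 0]),
    (![0, 0, 0, 0, 1, 0, 0, 0, 0], ![0, 0, 0, 0, -1, -1, 0, 0, 0]),
    (![1, -1, 0, -1, 0, 0, 0, 0, 0], ![-2, 2, 0, 1, 0, 1, 0, 0, 0]),
    (![1, 1, -1, -1, -1, -1, 0, 0, 1], ![0, 0, 0, 0, 0, 0, -1, 0, -1]),
    (![5, -3, -1, -1, -1, -1, -2, -3, -2], ![-2, 2, 0, 0, 0, 0, 1, 1, 0]),
    (![5, -3, -1, -1, -1, -1, -2, -2, -3], ![-2, 2, 0, 0, 0, 0, 0, 1, 1]),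
    (![1, 1, -1, -1, -1, -1, 1, 0, 0], ![0, 0, 0, 0, 0, 0, -1, -1, 0]),
    (![1, 1, -1, -1, -1, -1, 0, 1, 0], ![0, 0, 0, 0, 0, 0, 0, -1, -1]),
    (![5, -3, -1, -1, -1, -1, -3, -2, -2], ![-2, 2, 0, 0, 0, 0, 1, 0, 1]),
    (![0, 1, 0, 0, 0, 0, 0, 0, 0], ![0, 1, -1, 0, 0, 0, 2, 2, 2]),
    (![2, -1, -1, 0, 0, 0, -1, -1, -1], ![7, -6, 0, 0, 0, 0, -3, -3, -3]),
    (![2, -1, -1, -1, -1, -1, 0, 0, 0], ![1, 0, 0, -1, -1, -1, 2, 2, 2]),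
    (![3, -2, 0, -1, -1, -1, -1, -1, -1], ![9, -8, -1, -1, -1, -1, -3, -3, -3]),
    (![-3, 1, 1, 1, 1, 1, 1, 1, 1], ![2, 0, -1, -1, -1, -1, -1, -1, -1])}

theorem frame_map_actFirst : ∀ σ,
    frame.map (fun p => (actFirst σ p.1, actFirst σ p.2)) = frame := by
  decide +kernel

theorem frame_map_actSecond : ∀ σ,
    frame.map (fun p => (actSecond σ p.1, actSecond σ p.2)) = frame := by
  decide +kernel

theorem frame_map_act (s : Perm (Fin 3) × Perm (Fin 3)) :
    frame.map (fun p => (act s p.1, act s p.2)) = frame := by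
  conv_rhs => rw [← frame_map_actFirst s.1, ← frame_map_actSecond s.2, Multiset.map_map]
  rfl

theorem sum_frame (x : V) : (frame.map fun p => bil p.2 x • p.1).sum = x := by
  ext i
  fin_cases i <;> simp [frame, bil_eq] <;> ring

theorem condH1_range_actHom : CondH1 actHom.range := by
  intro G hG
  have : Finite actHom.range := Set.finite_range actHom
  have : Finite G := Finite.of_injective _ (Subgroup.inclusion_injective hG)
  refine subsingleton_H1_of_frame G (hG.trans range_actHom_le_W) frame (fun g hg => ?_) sum_frame
  obtain ⟨s, rfl⟩ := hG hg
  exact frame_map_act s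

/-- The orbit of `orbRep k` under `S₃ × S₃`. -/
def orbFinset (k : Fin 23) : Finset V := Finset.univ.image fun s => act s (orbRep k)

theorem orb_range_actHom (k : Fin 23) : orb actHom.range (orbRep k) = orbFinset k := by
  ext v
  simp [orb, orbFinset, actHom_apply]

theorem card_orbFinset (k : Fin 23) : (orbFinset k).card = orbLength k := by
  let := MulAction.compHom V actHom
  have h := (MulAction.stabilizer (Perm (Fin 3) × Perm (Fin 3)) (orbRep k)).index_mul_card
  have h1 : (MulAction.orbit (Perm (Fin 3) × Perm (Fin 3)) (orbRep k)).ncard =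
      (orbFinset k).card := by
    rw [← Set.ncard_coe_finset, orbFinset, Finset.coe_image, Finset.coe_univ, Set.image_univ]
    rfl
  have h2 : Nat.card (MulAction.stabilizer (Perm (Fin 3) × Perm (Fin 3)) (orbRep k)) =
      (Finset.univ.filter fun s => act s (orbRep k) = orbRep k).card :=
    Nat.subtype_card _ fun s => by
      rw [Finset.mem_filter, and_iff_right (Finset.mem_univ s)]
      rfl
  have h3 : Nat.card (Perm (Fin 3) × Perm (Fin 3)) = 36 := by
    rw [Nat.card_eq_fintype_card]
    decide
  rw [MulAction.index_stabilizer, h1, h2, h3, ← card_stabilizer k] at h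
  refine Nat.eq_of_mul_eq_mul_right (Finset.card_pos.2 ⟨1, ?_⟩) h
  simp [act_one]

theorem orbInv_of_mem_orbFinset {k : Fin 23} {v : V} (hv : v ∈ orbFinset k) :
    orbInv v = orbInv (orbRep k) := by
  obtain ⟨s, -, rfl⟩ := Finset.mem_image.1 hv
  exact orbInv_act s _

theorem orbRep_mem_orbFinset (k : Fin 23) : orbRep k ∈ orbFinset k :=
  Finset.mem_image.2 ⟨1, Finset.mem_univ _, by rw [act_one, LinearMap.id_apply]⟩

theorem exists_mem_orbFinset {E : V} (hE : E ∈ Exc) : ∃ k, E ∈ orbFinset k := by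
  let L : Finset V := ([0, 1, 2, 3, 4].flatMap candidates).toFinset
  have hsub : Finset.univ.biUnion orbFinset ⊆ L := by
    intro v hv
    obtain ⟨k, -, hv⟩ := Finset.mem_biUnion.1 hv
    obtain ⟨s, -, rfl⟩ := Finset.mem_image.1 hv
    obtain ⟨h1, h2⟩ := orbRep_mem_Exc k
    refine List.mem_toFinset.2 (mem_candidates ⟨?_, ?_⟩)
    · rw [bil_act, h1]
    · rw [← act_Kvec s, bil_act, h2]
  have hcard : (Finset.univ.biUnion orbFinset).card = 240 := by
    rw [Finset.card_biUnion]
    · simp only [card_orbFinset]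
      decide
    · intro k _ l _ hkl
      refine Finset.disjoint_left.2 fun v hk hl => hkl (orbInv_orbRep_injective ?_)
      exact (orbInv_of_mem_orbFinset hk).symm.trans (orbInv_of_mem_orbFinset hl)
  have heq := Finset.eq_of_subset_of_card_le hsub
    ((List.toFinset_card_le _).trans (by rw [length_candidates, hcard]))
  have hEL : E ∈ L := List.mem_toFinset.2 (mem_candidates hE)
  rw [← heq] at hEL
  obtain ⟨k, -, hk⟩ := Finset.mem_biUnion.1 hEL
  exact ⟨k, hk⟩

theorem orb_eq_of_mem {G : Subgroup LatAut} {E v : V} (hv : v ∈ orb G E) : orb G v = orb G E := by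
  obtain ⟨g, hg, rfl⟩ := hv
  ext w
  constructor
  · rintro ⟨h, hh, rfl⟩
    exact ⟨h * g, G.mul_mem hh hg, rfl⟩
  · rintro ⟨h, hh, rfl⟩
    exact ⟨h * g⁻¹, G.mul_mem hh (G.inv_mem hg), congrArg h (g.symm_apply_apply E)⟩

theorem exists_orb_eq {E : V} (hE : E ∈ Exc) : ∃ k, orb actHom.range E = orbFinset k := by
  obtain ⟨k, hk⟩ := exists_mem_orbFinset hE
  refine ⟨k, ?_⟩
  rw [← orb_range_actHom]
  refine orb_eq_of_mem ?_
  rw [orb_range_actHom]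
  exact hk

theorem coe_orbFinset_injective : Function.Injective fun k => (orbFinset k : Set V) := by
  intro k l h
  have hk := orbRep_mem_orbFinset k
  rw [Finset.coe_injective h] at hk
  exact orbInv_orbRep_injective (orbInv_of_mem_orbFinset hk)

theorem orbs_range_actHom : orbs actHom.range = Set.range fun k => (orbFinset k : Set V) := by
  ext S
  constructor
  · rintro ⟨E, hE, rfl⟩
    obtain ⟨k, hk⟩ := exists_orb_eq hE
    exact ⟨k, hk.symm⟩
  · rintro ⟨k, rfl⟩
    exact ⟨orbRep k, orbRep_mem_Exc k, (orb_range_actHom k).symm⟩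

theorem ncard_orbs_of_length (n : ℕ) : {S ∈ orbs actHom.range | S.ncard = n}.ncard =
    (Finset.univ.filter fun k => orbLength k = n).card := by
  have h : {S ∈ orbs actHom.range | S.ncard = n} =
      (fun k => (orbFinset k : Set V)) '' (Finset.univ.filter fun k => orbLength k = n) := by
    rw [orbs_range_actHom]
    ext S
    constructor
    · rintro ⟨⟨k, rfl⟩, hk⟩
      refine ⟨k, ?_, rfl⟩
      simpa [card_orbFinset] using hk
    · rintro ⟨k, hk, rfl⟩
      refine ⟨⟨k, rfl⟩, ?_⟩
      simpa [card_orbFinset] using hk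
  rw [h, Set.ncard_image_of_injective _ coe_orbFinset_injective, Set.ncard_coe_finset]

theorem minimalAction_range_actHom : MinimalAction actHom.range := by
  intro E hE h
  obtain ⟨k, hk⟩ := exists_orb_eq hE
  obtain ⟨s, hne, hs⟩ := exists_bil_act k
  rw [hk] at h
  exact hs (h _ (Finset.mem_image_of_mem _ (Finset.mem_univ s)) _ (orbRep_mem_orbFinset k) hne)

theorem act_conic : ∀ s, act s ![1, -1, 0, 0, 0, 0, 0, 0, 0] = ![1, -1, 0, 0, 0, 0, 0, 0, 0] := by
  decide +kernel

theorem exists_dp1_S3xS3_conic :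
    ∃ G : Subgroup LatAut, G ≤ W ∧
      Nonempty (G ≃* (Equiv.Perm (Fin 3) × Equiv.Perm (Fin 3))) ∧
      (orbs G).ncard = 23 ∧
      {S ∈ orbs G | S.ncard = 2}.ncard = 2 ∧
      {S ∈ orbs G | S.ncard = 3}.ncard = 4 ∧
      {S ∈ orbs G | S.ncard = 4}.ncard = 2 ∧
      {S ∈ orbs G | S.ncard = 6}.ncard = 6 ∧
      {S ∈ orbs G | S.ncard = 12}.ncard = 6 ∧
      {S ∈ orbs G | S.ncard = 36}.ncard = 3 ∧
      MinimalAction G ∧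
      (∃ C, IsConic C ∧ ∀ g ∈ G, g C = C) ∧
      CondH1 G := by
  refine ⟨actHom.range, range_actHom_le_W, ⟨(MonoidHom.ofInjective actHom_injective).symm⟩, ?_,
    ?_, ?_, ?_, ?_, ?_, ?_, minimalAction_range_actHom, ?_, condH1_range_actHom⟩
  · rw [orbs_range_actHom, Set.ncard_range_of_injective coe_orbFinset_injective, Nat.card_fin]
  · rw [ncard_orbs_of_length]
    decide
  · rw [ncard_orbs_of_length]
    decide
  · rw [ncard_orbs_of_length]
    decide
  · rw [ncard_orbs_of_length]
    decide
  · rw [ncard_orbs_of_length]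
    decide
  · rw [ncard_orbs_of_length]
    decide
  · refine ⟨![1, -1, 0, 0, 0, 0, 0, 0, 0], ⟨?_, ?_⟩, ?_⟩
    · rw [bil_eq]
      decide
    · rw [bil_eq]
      decide
    · rintro _ ⟨s, rfl⟩
      exact act_conic s

end
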